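/- arXiv:2311.08691 — 5 statements merged into one kernel-verified Lean document; each statement's English description precedes it below -/
import Mathlib

section
/- Projection identity for general finite-valued outcome and instrument (second example following Result 1): Let Y take values in the finite set {0,1,...,ℓ_y}, Z in {0,1,...,ℓ_z}, let U take values in a measurable space, and suppose Y and Z are conditionally independent given σ(U). Let f(W) be any bounded measurable real-valued function of W = (Y,Z,U), and define f†(W) = E[f(W) | σ(Z,U)] + E[f(W) | σ(Y,U)] − E[f(W) | σ(U)]. Then there exist bounded measurable functions c_{jk}(U), for j ∈ {1,...,ℓ_y} and k ∈ {1,...,ℓ_z}, such that almost surely f(W) − f†(W) = Σ_{j=1}^{ℓ_y} Σ_{k=1}^{ℓ_z} c_{jk}(U) · (1{Y=j} − P(Y=j | σ(U))) · (1{Z=k} − P(Z=k | σ(U))), where P(Y=j | σ(U)) denotes a version of E[1{Y=j} | σ(U)] and similarly for Z. -/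
open MeasureTheory ProbabilityTheory

lemma aux_ind_meas {Ω : Type*} {m : MeasurableSpace Ω} {Y : Ω → ℕ} (hY : Measurable[m] Y) (j : ℕ) :
    StronglyMeasurable[m] (fun ω => if Y ω = j then (1 : ℝ) else 0) := by
  refine Measurable.stronglyMeasurable ?_
  exact Measurable.ite (hY (measurableSet_singleton j)) measurable_const measurable_const

lemma aux_ind_eq {Ω : Type*} (Y : Ω → ℕ) (j : ℕ) :
    (fun ω => if Y ω = j then (1 : ℝ) else 0) = (Y ⁻¹' {j}).indicator (fun _ => (1 : ℝ)) := by
  ext ω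
  by_cases h : Y ω = j <;> simp [h]

lemma aux_ind_bd {Ω : Type*} (Y : Ω → ℕ) (j : ℕ) (ω : Ω) :
    ‖(if Y ω = j then (1 : ℝ) else 0)‖ ≤ 1 := by
  split_ifs <;> simp

lemma aux_int {Ω : Type*} {mΩ : MeasurableSpace Ω} {μ : Measure Ω} [IsProbabilityMeasure μ]
    {g : Ω → ℝ} (hg : StronglyMeasurable g) (C : ℝ) (h : ∀ ω, ‖g ω‖ ≤ C) : Integrable g μ :=
  Integrable.of_bound hg.aestronglyMeasurable C (ae_of_all _ h)

/-- Enlarging the conditioning by a conditionally independent variable changes nothing. -/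
lemma aux_drop {Ω 𝒰 : Type*} {mΩ : MeasurableSpace Ω} [StandardBorelSpace Ω] [MeasurableSpace 𝒰]
    (μ : Measure Ω) [IsProbabilityMeasure μ]
    (Y Z : Ω → ℕ) (hY : Measurable Y) (hZ : Measurable Z)
    (U : Ω → 𝒰) (hU : Measurable U)
    (hind : CondIndepFun (MeasurableSpace.comap U inferInstance) hU.comap_le Z Y μ) (j : ℕ) :
    μ[fun ω => if Y ω = j then (1 : ℝ) else 0 |
        MeasurableSpace.comap (fun ω => (Z ω, U ω)) inferInstance] =ᵐ[μ]
      μ[fun ω => if Y ω = j then (1 : ℝ) else 0 | MeasurableSpace.comap U inferInstance] := by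
  have hsw : MeasurableSpace.comap (fun ω => (Z ω, U ω)) inferInstance
      = MeasurableSpace.comap (fun ω => (U ω, Z ω)) inferInstance := by
    apply le_antisymm
    · rw [← measurable_iff_comap_le]
      exact measurable_swap.comp (comap_measurable (fun ω => (U ω, Z ω)))
    · rw [← measurable_iff_comap_le]
      exact measurable_swap.comp (comap_measurable (fun ω => (Z ω, U ω)))
  rw [hsw, aux_ind_eq]
  have h := (condIndepFun_iff_condDistrib_prod_ae_eq_prodMkRight hY hZ hU).1 hind
  have h' := ae_of_ae_map (hU.prodMk hZ).aemeasurable h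
  have h1 := condDistrib_ae_eq_condExp (μ := μ) (hU.prodMk hZ) hY (measurableSet_singleton j)
  have h2 := condDistrib_ae_eq_condExp (μ := μ) hU hY (measurableSet_singleton j)
  filter_upwards [h', h1, h2] with ω a b c
  rw [← b, ← c, measureReal_def, measureReal_def, a]
  rfl

lemma aux_mul {Ω : Type*} {mΩ : MeasurableSpace Ω} [StandardBorelSpace Ω]
    (μ : Measure Ω) [IsProbabilityMeasure μ]
    (Y Z : Ω → ℕ) (hY : Measurable Y) (hZ : Measurable Z)
    {mU : MeasurableSpace Ω} (hmU : mU ≤ mΩ)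
    (hind : CondIndepFun mU hmU Y Z μ) (j k : ℕ) :
    μ[fun ω => (if Y ω = j then (1 : ℝ) else 0) * (if Z ω = k then (1 : ℝ) else 0) | mU] =ᵐ[μ]
      fun ω => (μ[fun ω => if Y ω = j then (1 : ℝ) else 0 | mU]) ω *
        (μ[fun ω => if Z ω = k then (1 : ℝ) else 0 | mU]) ω := by
  have h := (condIndepFun_iff_condExp_inter_preimage_eq_mul hY hZ).1 hind {j} {k}
    (measurableSet_singleton j) (measurableSet_singleton k)
  have e : (fun ω => (if Y ω = j then (1 : ℝ) else 0) * (if Z ω = k then (1 : ℝ) else 0))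
      = (Y ⁻¹' {j} ∩ Z ⁻¹' {k}).indicator (fun _ => (1 : ℝ)) := by
    ext ω
    by_cases h1 : Y ω = j <;> by_cases h2 : Z ω = k <;> simp [h1, h2]
  rw [e, aux_ind_eq, aux_ind_eq]
  exact h

/-- Conditional expectation of a finite double sum, term by term pull-out. -/
lemma aux_sum {Ω : Type*} {mΩ : MeasurableSpace Ω}
    (μ : Measure Ω) [IsProbabilityMeasure μ] {m : MeasurableSpace Ω} (hm : m ≤ mΩ)
    (S T : Finset ℕ) (A G P : ℕ → ℕ → Ω → ℝ) (C : ℝ)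
    (hA : ∀ j k, StronglyMeasurable[m] (A j k)) (hAb : ∀ j k ω, ‖A j k ω‖ ≤ C)
    (hG : ∀ j k, Integrable (G j k) μ)
    (hP : ∀ j k, μ[G j k | m] =ᵐ[μ] P j k) :
    μ[fun ω => ∑ j ∈ S, ∑ k ∈ T, A j k ω * G j k ω | m] =ᵐ[μ]
      fun ω => ∑ j ∈ S, ∑ k ∈ T, A j k ω * P j k ω := by
  have hint : ∀ j k, Integrable (A j k * G j k) μ := fun j k =>
    (hG j k).bdd_mul ((hA j k).mono hm).aestronglyMeasurable (ae_of_all _ (hAb j k))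
  have e : (fun ω => ∑ j ∈ S, ∑ k ∈ T, A j k ω * G j k ω)
      = ∑ p ∈ S ×ˢ T, (A p.1 p.2 * G p.1 p.2) := by
    ext ω
    simp [Finset.sum_apply, Finset.sum_product]
  rw [e]
  have h1 := condExp_finsetSum (μ := μ) (s := S ×ˢ T) (f := fun p => A p.1 p.2 * G p.1 p.2)
    (fun p _ => hint p.1 p.2) m
  have h2 : ∀ᵐ ω ∂μ, ∀ j k, (μ[A j k * G j k | m]) ω = A j k ω * P j k ω := by
    rw [ae_all_iff]; intro j
    rw [ae_all_iff]; intro k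
    filter_upwards [condExp_stronglyMeasurable_mul_of_bound hm (hA j k) (hG j k) C
      (ae_of_all _ (hAb j k)), hP j k] with ω a b
    rw [a, Pi.mul_apply, b]
  filter_upwards [h1, h2] with ω a b
  rw [a, Finset.sum_apply, Finset.sum_product]
  exact Finset.sum_congr rfl fun j _ => Finset.sum_congr rfl fun k _ => b j k

lemma aux_sum_ind {Ω : Type*} {mΩ : MeasurableSpace Ω}
    (μ : Measure Ω) [IsProbabilityMeasure μ] {m : MeasurableSpace Ω} (hm : m ≤ mΩ)
    (Y : Ω → ℕ) (hY : Measurable[mΩ] Y) (n : ℕ) (hn : ∀ ω, Y ω ≤ n) :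
    ∀ᵐ ω ∂μ, ∑ j ∈ Finset.range (n + 1), ((if Y ω = j then (1 : ℝ) else 0)
                    - (μ[fun ω' => if Y ω' = j then (1 : ℝ) else 0 | m]) ω) = 0 := by
  have h1 := condExp_finsetSum (μ := μ) (s := Finset.range (n + 1))
    (f := fun j ω => if Y ω = j then (1 : ℝ) else 0)
    (fun j _ => aux_int (aux_ind_meas hY j) 1 (aux_ind_bd Y j)) m
  have e : ∀ ω, ∑ j ∈ Finset.range (n + 1), (if Y ω = j then (1 : ℝ) else 0) = 1 := by
    intro ω
    rw [Finset.sum_ite_eq]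
    simp [Nat.lt_succ_of_le (hn ω)]
  have e2 : (∑ j ∈ Finset.range (n + 1), fun ω => if Y ω = j then (1 : ℝ) else 0)
      = fun _ => (1 : ℝ) := by
    ext ω
    rw [Finset.sum_apply]; exact e ω
  rw [e2, condExp_const hm] at h1
  filter_upwards [h1] with ω a
  rw [Finset.sum_apply] at a
  rw [Finset.sum_sub_distrib, e, ← a, sub_self]

lemma aux_alg (n m : ℕ) (a : ℕ → ℕ → ℝ) (x y : ℕ → ℝ)
    (hx : ∑ j ∈ Finset.range (n + 1), x j = 0) (hy : ∑ k ∈ Finset.range (m + 1), y k = 0) :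
    ∑ j ∈ Finset.range (n + 1), ∑ k ∈ Finset.range (m + 1), a j k * x j * y k
      = ∑ j ∈ Finset.Icc 1 n, ∑ k ∈ Finset.Icc 1 m,
          (a j k - a 0 k - a j 0 + a 0 0) * x j * y k := by
  have key : ∑ j ∈ Finset.range (n + 1), ∑ k ∈ Finset.range (m + 1), a j k * x j * y k
      = ∑ j ∈ Finset.range (n + 1), ∑ k ∈ Finset.range (m + 1),
          (a j k - a 0 k - a j 0 + a 0 0) * x j * y k := by
    have h1 : ∑ j ∈ Finset.range (n + 1), ∑ k ∈ Finset.range (m + 1), a 0 k * x j * y k = 0 := by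
      rw [Finset.sum_comm]
      refine Finset.sum_eq_zero fun k _ => ?_
      rw [← Finset.sum_mul, ← Finset.mul_sum, hx]; simp
    have h2 : ∑ j ∈ Finset.range (n + 1), ∑ k ∈ Finset.range (m + 1), a j 0 * x j * y k = 0 := by
      refine Finset.sum_eq_zero fun k _ => ?_
      rw [← Finset.mul_sum, hy]; simp
    have h3 : ∑ j ∈ Finset.range (n + 1), ∑ k ∈ Finset.range (m + 1), a 0 0 * x j * y k = 0 := by
      refine Finset.sum_eq_zero fun k _ => ?_
      rw [← Finset.mul_sum, hy]; simp
    simp only [add_mul, sub_mul, Finset.sum_add_distrib, Finset.sum_sub_distrib, h1, h2, h3]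
    simp
  have r : ∀ (N : ℕ) (g : ℕ → ℝ), g 0 = 0 →
      ∑ j ∈ Finset.range (N + 1), g j = ∑ j ∈ Finset.Icc 1 N, g j := by
    intro N g hg
    symm
    refine Finset.sum_subset (fun j hj => ?_) (fun j hj hj' => ?_)
    · simp at hj ⊢; omega
    · have : j = 0 := by simp at hj hj'; omega
      rw [this, hg]
  rw [key, r]
  · refine Finset.sum_congr rfl fun j _ => ?_
    rw [r]
    simp
  · refine Finset.sum_eq_zero fun k _ => ?_
    simp

/-- **Projection identity for general finite-valued outcome and instrument
(second example following Result 1).**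
`Y` takes values in `{0,1,...,ℓy}`, `Z` in `{0,1,...,ℓz}`, and `Y`, `Z` are
conditionally independent given `σ(U)`.  For any bounded measurable real-valued
`f(W)` of `W = (Y,Z,U)`, setting
`f†(W) = E[f(W) | σ(Z,U)] + E[f(W) | σ(Y,U)] − E[f(W) | σ(U)]`, there exist
bounded `σ(U)`-measurable functions `c_{jk}(U)`, `j ∈ {1,...,ℓy}`,
`k ∈ {1,...,ℓz}`, such that almost surely
`f(W) − f†(W) = Σ_{j=1}^{ℓy} Σ_{k=1}^{ℓz} c_{jk}(U) · (1{Y=j} − P(Y=j | σ(U))) ·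
(1{Z=k} − P(Z=k | σ(U)))`. -/
theorem projection_identity_finite
    {Ω 𝒰 : Type*} [mΩ : MeasurableSpace Ω] [StandardBorelSpace Ω] [MeasurableSpace 𝒰]
    (μ : Measure Ω) [IsProbabilityMeasure μ]
    (ℓy ℓz : ℕ)
    (Y Z : Ω → ℕ) (hY : Measurable Y) (hZ : Measurable Z)
    (hYle : ∀ ω, Y ω ≤ ℓy) (hZle : ∀ ω, Z ω ≤ ℓz)
    (U : Ω → 𝒰) (hU : Measurable U)
    (mU mYU mZU : MeasurableSpace Ω)
    (hmU : mU = MeasurableSpace.comap U inferInstance)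
    (hmYU : mYU = MeasurableSpace.comap (fun ω => (Y ω, U ω)) inferInstance)
    (hmZU : mZU = MeasurableSpace.comap (fun ω => (Z ω, U ω)) inferInstance)
    (hmUle : mU ≤ mΩ)
    (hind : @CondIndepFun Ω mU mΩ _ hmUle ℕ ℕ _ _ Y Z μ _)
    (f : ℕ × ℕ × 𝒰 → ℝ) (hf : Measurable f) (hfbd : ∃ C, ∀ w, |f w| ≤ C)
    (F : Ω → ℝ) (hF : F = fun ω => f (Y ω, Z ω, U ω)) :
    ∃ c : ℕ → ℕ → Ω → ℝ,
      (∀ j k, StronglyMeasurable[mU] (c j k)) ∧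
      (∀ j k, ∃ C, ∀ ω, |c j k ω| ≤ C) ∧
      ∀ᵐ ω ∂μ,
        F ω - ((μ[F | mZU]) ω + (μ[F | mYU]) ω - (μ[F | mU]) ω)
          = ∑ j ∈ Finset.Icc 1 ℓy, ∑ k ∈ Finset.Icc 1 ℓz,
              c j k ω
                * ((if Y ω = j then (1 : ℝ) else 0)
                    - (μ[fun ω' => if Y ω' = j then (1 : ℝ) else 0 | mU]) ω)
                * ((if Z ω = k then (1 : ℝ) else 0)
                    - (μ[fun ω' => if Z ω' = k then (1 : ℝ) else 0 | mU]) ω) := by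
  subst hmU hmYU hmZU
  obtain ⟨C, hC⟩ := hfbd
  have hC0 : 0 ≤ C := (abs_nonneg _).trans (hC (0, 0, U (Classical.choice (by
    by_contra h
    rw [not_nonempty_iff] at h
    exact (IsProbabilityMeasure.ne_zero μ) (Measure.eq_zero_of_isEmpty μ)))))
  set mU : MeasurableSpace Ω := MeasurableSpace.comap U inferInstance with hmU
  set mYU : MeasurableSpace Ω :=
    MeasurableSpace.comap (fun ω => (Y ω, U ω)) inferInstance with hmYU
  set mZU : MeasurableSpace Ω :=
    MeasurableSpace.comap (fun ω => (Z ω, U ω)) inferInstance with hmZU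
  have hYUle : mYU ≤ mΩ := (hY.prodMk hU).comap_le
  have hZUle : mZU ≤ mΩ := (hZ.prodMk hU).comap_le
  have hUm : Measurable[mU] U := comap_measurable U
  have hYUm : Measurable[mYU] (fun ω => (Y ω, U ω)) := comap_measurable _
  have hZUm : Measurable[mZU] (fun ω => (Z ω, U ω)) := comap_measurable _
  have hfjk : ∀ j k, Measurable (fun u => f (j, k, u)) := fun j k => by fun_prop
  -- coefficient functions
  let a : ℕ → ℕ → Ω → ℝ := fun j k ω => f (j, k, U ω)
  have haU : ∀ j k, StronglyMeasurable[mU] (a j k) := fun j k =>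
    ((hfjk j k).comp hUm).stronglyMeasurable
  have haYU : ∀ j k, StronglyMeasurable[mYU] (a j k) := fun j k =>
    ((hfjk j k).comp (measurable_snd.comp hYUm)).stronglyMeasurable
  have haZU : ∀ j k, StronglyMeasurable[mZU] (a j k) := fun j k =>
    ((hfjk j k).comp (measurable_snd.comp hZUm)).stronglyMeasurable
  have hab : ∀ j k ω, ‖a j k ω‖ ≤ C := fun j k ω => hC _
  let I : ℕ → Ω → ℝ := fun j ω => if Y ω = j then (1 : ℝ) else 0
  let J : ℕ → Ω → ℝ := fun k ω => if Z ω = k then (1 : ℝ) else 0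
  have hIm : ∀ j, StronglyMeasurable[mΩ] (I j) := fun j => aux_ind_meas hY j
  have hJm : ∀ k, StronglyMeasurable[mΩ] (J k) := fun k => aux_ind_meas hZ k
  have hIYU : ∀ j, StronglyMeasurable[mYU] (I j) := fun j =>
    aux_ind_meas (measurable_fst.comp hYUm) j
  have hJZU : ∀ k, StronglyMeasurable[mZU] (J k) := fun k =>
    aux_ind_meas (measurable_fst.comp hZUm) k
  have hIb : ∀ j ω, ‖I j ω‖ ≤ 1 := fun j ω => aux_ind_bd Y j ω
  have hJb : ∀ j ω, ‖J j ω‖ ≤ 1 := fun j ω => aux_ind_bd Z j ω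
  have hII : ∀ j, Integrable (I j) μ := fun j => aux_int (hIm j) 1 (hIb j)
  have hJI : ∀ j, Integrable (J j) μ := fun j => aux_int (hJm j) 1 (hJb j)
  have hmulb : ∀ x y : ℝ, ‖x‖ ≤ C → ‖y‖ ≤ 1 → ‖x * y‖ ≤ C := fun x y hx hy => by
    rw [norm_mul]
    calc ‖x‖ * ‖y‖ ≤ C * 1 := mul_le_mul hx hy (norm_nonneg _) hC0
      _ = C := mul_one C
  have hFsum : ∀ ω, F ω = ∑ j ∈ Finset.range (ℓy + 1), ∑ k ∈ Finset.range (ℓz + 1),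
      a j k ω * (I j ω * J k ω) := by
    intro ω
    rw [Finset.sum_eq_single (Y ω), Finset.sum_eq_single (Z ω)]
    · simp [hF, a, I, J]
    · intro k _ hk
      simp [J, hk.symm]
    · intro h
      exact absurd (Finset.mem_range.2 (Nat.lt_succ_of_le (hZle ω))) h
    · intro j _ hj
      simp [I, hj.symm]
    · intro h
      exact absurd (Finset.mem_range.2 (Nat.lt_succ_of_le (hYle ω))) h
  have eU : μ[F | mU] =ᵐ[μ] fun ω => ∑ j ∈ Finset.range (ℓy + 1),
      ∑ k ∈ Finset.range (ℓz + 1), a j k ω * ((μ[I j | mU]) ω * (μ[J k | mU]) ω) := by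
    have := aux_sum μ hmUle (Finset.range (ℓy + 1)) (Finset.range (ℓz + 1)) a
      (fun j k ω => I j ω * J k ω) (fun j k ω => (μ[I j | mU]) ω * (μ[J k | mU]) ω) C haU hab
      (fun j k => aux_int ((hIm j).mul (hJm k)) 1 (fun ω => by
        rw [norm_mul]; exact mul_le_one₀ (hIb j ω) (norm_nonneg _) (hJb k ω)))
      (fun j k => aux_mul μ Y Z hY hZ hmUle hind j k)
    rwa [← funext hFsum] at this
  have eZ : μ[F | mZU] =ᵐ[μ] fun ω => ∑ j ∈ Finset.range (ℓy + 1),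
      ∑ k ∈ Finset.range (ℓz + 1), (a j k ω * J k ω) * (μ[I j | mU]) ω := by
    have := aux_sum μ hZUle (Finset.range (ℓy + 1)) (Finset.range (ℓz + 1))
      (fun j k ω => a j k ω * J k ω)
      (fun j k ω => I j ω) (fun j k ω => (μ[I j | mU]) ω) C
      (fun j k => (haZU j k).mul (hJZU k)) (fun j k ω => hmulb _ _ (hab j k ω) (hJb k ω))
      (fun j k => hII j)
      (fun j k => aux_drop μ Y Z hY hZ U hU hind.symm j)
    have e : F = fun ω => ∑ j ∈ Finset.range (ℓy + 1), ∑ k ∈ Finset.range (ℓz + 1),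
        (a j k ω * J k ω) * I j ω := by
      ext ω
      rw [hFsum]
      exact Finset.sum_congr rfl fun j _ => Finset.sum_congr rfl fun k _ => by ring
    rwa [← e] at this
  have eY : μ[F | mYU] =ᵐ[μ] fun ω => ∑ j ∈ Finset.range (ℓy + 1),
      ∑ k ∈ Finset.range (ℓz + 1), (a j k ω * I j ω) * (μ[J k | mU]) ω := by
    have := aux_sum μ hYUle (Finset.range (ℓy + 1)) (Finset.range (ℓz + 1))
      (fun j k ω => a j k ω * I j ω)
      (fun j k ω => J k ω) (fun j k ω => (μ[J k | mU]) ω) C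
      (fun j k => (haYU j k).mul (hIYU j)) (fun j k ω => hmulb _ _ (hab j k ω) (hIb j ω))
      (fun j k => hJI k)
      (fun j k => aux_drop μ Z Y hZ hY U hU hind k)
    have e : F = fun ω => ∑ j ∈ Finset.range (ℓy + 1), ∑ k ∈ Finset.range (ℓz + 1),
        (a j k ω * I j ω) * J k ω := by
      ext ω
      rw [hFsum]
      exact Finset.sum_congr rfl fun j _ => Finset.sum_congr rfl fun k _ => by ring
    rwa [← e] at this
  refine ⟨fun j k ω => a j k ω - a 0 k ω - a j 0 ω + a 0 0 ω, fun j k =>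
    (((haU j k).sub (haU 0 k)).sub (haU j 0)).add (haU 0 0), fun j k => ⟨4 * C, fun ω => ?_⟩, ?_⟩
  · have h1 := abs_le.1 (hab j k ω)
    have h2 := abs_le.1 (hab 0 k ω)
    have h3 := abs_le.1 (hab j 0 ω)
    have h4 := abs_le.1 (hab 0 0 ω)
    rw [abs_le]
    constructor <;> linarith [h1.1, h1.2, h2.1, h2.2, h3.1, h3.2, h4.1, h4.2]
  · filter_upwards [eU, eZ, eY, aux_sum_ind μ hmUle Y hY ℓy hYle,
      aux_sum_ind μ hmUle Z hZ ℓz hZle] with ω h1 h2 h3 h4 h5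
    rw [← aux_alg ℓy ℓz (fun j k => a j k ω)
      (fun j => (if Y ω = j then (1 : ℝ) else 0)
                    - (μ[fun ω' => if Y ω' = j then (1 : ℝ) else 0 | mU]) ω)
      (fun k => (if Z ω = k then (1 : ℝ) else 0)
                    - (μ[fun ω' => if Z ω' = k then (1 : ℝ) else 0 | mU]) ω) h4 h5]
    rw [h1, h2, h3, hFsum]
    simp only [← Finset.sum_add_distrib, ← Finset.sum_sub_distrib]
    refine Finset.sum_congr rfl fun j _ => Finset.sum_congr rfl fun k _ => ?_
    simp only [I, J]
    ring
end

section
/- Exponential tilting representation of the outcome distribution among nonrespondents (equation (2.8) of the paper, discrete case): Let (Y, Z, U, R) take values in finite sets with Y ∈ 𝒴 finite and R ∈ {0,1}, write X = (Z,U), and suppose that for every (y,x) with P(Y=y, X=x) > 0, P(R=1 | Y=y, X=x) = expit(η(x) + h(y,x)), where η and h are real-valued functions. Then for every x with P(R=0, X=x) > 0 and P(R=1, X=x) > 0, and every y ∈ 𝒴 with P(Y=y, X=x) > 0: P(Y=y | R=0, X=x) = exp(−h(y,x)) · P(Y=y | R=1, X=x) / Σ_{t ∈ 𝒴, P(Y=t,X=x)>0}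 exp(−h(t,x)) · P(Y=t | R=1, X=x). -/
open MeasureTheory

/-- Elementary conditional probability `P(A | B) = P(A ∩ B)/P(B)` (as a real
number; it is `0` when `P(B) = 0`). -/
noncomputable def condP {Ω : Type*} [MeasurableSpace Ω]
    (μ : Measure Ω) (A B : Set Ω) : ℝ :=
  (μ (A ∩ B)).toReal / (μ B).toReal

/-- The inverse logit function `expit(t) = 1/(1 + exp(−t))`. -/
noncomputable def expit (t : ℝ) : ℝ := (1 + Real.exp (-t))⁻¹

open Classical in
/-- **Exponential tilting representation of the outcome distribution among
nonrespondents (equation (2.8) of the paper, discrete case).**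
All variables take finitely many values, `X = (Z,U)`, and for every `(y,x)` with
`P(Y=y, X=x) > 0`, `P(R=1 | Y=y, X=x) = expit(η(x) + h(y,x))`.  Then for every
`x` with `P(R=0, X=x) > 0` and `P(R=1, X=x) > 0`, and every `y` with
`P(Y=y, X=x) > 0`:
`P(Y=y | R=0, X=x) = exp(−h(y,x)) · P(Y=y | R=1, X=x) /
  Σ_{t : P(Y=t,X=x) > 0} exp(−h(t,x)) · P(Y=t | R=1, X=x)`. -/
theorem exp_tilting_nonrespondents
    {Ω 𝒴 𝒵 𝒰 : Type*} [MeasurableSpace Ω]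
    [Fintype 𝒴] [MeasurableSpace 𝒴] [MeasurableSingletonClass 𝒴]
    [Fintype 𝒵] [MeasurableSpace 𝒵] [MeasurableSingletonClass 𝒵]
    [Fintype 𝒰] [MeasurableSpace 𝒰] [MeasurableSingletonClass 𝒰]
    (μ : Measure Ω) [IsProbabilityMeasure μ]
    (Y : Ω → 𝒴) (hY : Measurable Y)
    (Z : Ω → 𝒵) (hZ : Measurable Z)
    (U : Ω → 𝒰) (hU : Measurable U)
    (R : Ω → Bool) (hR : Measurable R)
    (η : 𝒵 × 𝒰 → ℝ) (h : 𝒴 → 𝒵 × 𝒰 → ℝ)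
    (hmodel : ∀ (y : 𝒴) (x : 𝒵 × 𝒰),
      0 < μ {ω | Y ω = y ∧ (Z ω, U ω) = x} →
      condP μ {ω | R ω = true} {ω | Y ω = y ∧ (Z ω, U ω) = x}
        = expit (η x + h y x)) :
    ∀ x : 𝒵 × 𝒰,
      0 < μ {ω | R ω = false ∧ (Z ω, U ω) = x} →
      0 < μ {ω | R ω = true ∧ (Z ω, U ω) = x} →
      ∀ y : 𝒴, 0 < μ {ω | Y ω = y ∧ (Z ω, U ω) = x} →
        condP μ {ω | Y ω = y} {ω | R ω = false ∧ (Z ω, U ω) = x}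
          = Real.exp (-h y x)
              * condP μ {ω | Y ω = y} {ω | R ω = true ∧ (Z ω, U ω) = x}
            / ∑ t ∈ Finset.univ.filter
                (fun t : 𝒴 => 0 < μ {ω | Y ω = t ∧ (Z ω, U ω) = x}),
                Real.exp (-h t x)
                  * condP μ {ω | Y ω = t} {ω | R ω = true ∧ (Z ω, U ω) = x} := by
  intro x hB hA y hy
  have hX : MeasurableSet {ω | (Z ω, U ω) = x} :=
    (hZ.prodMk hU) (measurableSet_singleton x)
  have hYt : ∀ t, MeasurableSet {ω | Y ω = t} := fun t => hY (measurableSet_singleton t)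
  have hRb : ∀ b, MeasurableSet {ω | R ω = b} := fun b => hR (measurableSet_singleton b)
  have hBm : MeasurableSet {ω | R ω = false ∧ (Z ω, U ω) = x} := (hRb false).inter hX
  have hB0 : 0 < μ.real {ω | R ω = false ∧ (Z ω, U ω) = x} :=
    ENNReal.toReal_pos hB.ne' (measure_ne_top _ _)
  have hA0 : 0 < μ.real {ω | R ω = true ∧ (Z ω, U ω) = x} :=
    ENNReal.toReal_pos hA.ne' (measure_ne_top _ _)
  -- key relation between the two joint masses
  have key : ∀ t, 0 < μ {ω | Y ω = t ∧ (Z ω, U ω) = x} →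
      Real.exp (-h t x) * μ.real ({ω | Y ω = t} ∩ {ω | R ω = true ∧ (Z ω, U ω) = x})
        = Real.exp (η x)
          * μ.real ({ω | Y ω = t} ∩ {ω | R ω = false ∧ (Z ω, U ω) = x}) := by
    intro t ht
    have hm := hmodel t x ht
    have ht0 : 0 < μ.real {ω | Y ω = t ∧ (Z ω, U ω) = x} :=
      ENNReal.toReal_pos ht.ne' (measure_ne_top _ _)
    have hsplit := measureReal_inter_add_diff (μ := μ)
      (s := {ω | Y ω = t ∧ (Z ω, U ω) = x}) (hRb true)
    have e1 : {ω | Y ω = t ∧ (Z ω, U ω) = x} ∩ {ω | R ω = true}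
        = {ω | Y ω = t} ∩ {ω | R ω = true ∧ (Z ω, U ω) = x} := by
      ext ω; simp only [Set.mem_inter_iff, Set.mem_setOf_eq]; tauto
    have e2 : {ω | Y ω = t ∧ (Z ω, U ω) = x} \ {ω | R ω = true}
        = {ω | Y ω = t} ∩ {ω | R ω = false ∧ (Z ω, U ω) = x} := by
      ext ω
      simp only [Set.mem_inter_iff, Set.mem_diff, Set.mem_setOf_eq, Bool.not_eq_true]; tauto
    unfold condP expit at hm
    rw [Set.inter_comm, e1] at hm
    rw [e1, e2] at hsplit
    change μ.real _ / μ.real _ = _ at hm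
    have hpos : 0 < 1 + Real.exp (-(η x + h t x)) := by positivity
    rw [div_eq_iff ht0.ne', ← hsplit, inv_mul_eq_div, eq_div_iff hpos.ne'] at hm
    have hb : μ.real ({ω | Y ω = t} ∩ {ω | R ω = false ∧ (Z ω, U ω) = x})
        = μ.real ({ω | Y ω = t} ∩ {ω | R ω = true ∧ (Z ω, U ω) = x})
          * Real.exp (-(η x + h t x)) := by linarith
    have he : Real.exp (-h t x) = Real.exp (η x) * Real.exp (-(η x + h t x)) := by
      rw [← Real.exp_add]; congr 1; ring
    rw [hb, he]; ring
  have hsum : ∑ t ∈ Finset.univ.filter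
      (fun t : 𝒴 => 0 < μ {ω | Y ω = t ∧ (Z ω, U ω) = x}),
      μ.real ({ω | Y ω = t} ∩ {ω | R ω = false ∧ (Z ω, U ω) = x})
      = μ.real {ω | R ω = false ∧ (Z ω, U ω) = x} := by
    rw [Finset.sum_filter_of_ne]
    · rw [← measureReal_biUnion_finset]
      · congr 1
        ext ω; simp
      · intro i _ j _ hij
        refine Set.disjoint_left.mpr ?_
        rintro ω ⟨h1, _⟩ ⟨h2, _⟩
        exact hij (h1.symm.trans h2)
      · intro t _
        exact (hYt t).inter hBm
    · intro t _ hne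
      rw [pos_iff_ne_zero]
      intro h0
      apply hne
      have : μ ({ω | Y ω = t} ∩ {ω | R ω = false ∧ (Z ω, U ω) = x}) = 0 :=
        measure_mono_null (t := {ω | Y ω = t ∧ (Z ω, U ω) = x})
          (fun ω hω => ⟨hω.1, hω.2.2⟩) h0
      simp [Measure.real, this]
  have hterm : ∀ t, 0 < μ {ω | Y ω = t ∧ (Z ω, U ω) = x} →
      Real.exp (-h t x) * condP μ {ω | Y ω = t} {ω | R ω = true ∧ (Z ω, U ω) = x}
        = (Real.exp (η x) / μ.real {ω | R ω = true ∧ (Z ω, U ω) = x})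
          * μ.real ({ω | Y ω = t} ∩ {ω | R ω = false ∧ (Z ω, U ω) = x}) := by
    intro t ht
    have := key t ht
    change _ * (μ.real _ / μ.real _) = _
    rw [← mul_div_assoc, this]; ring
  rw [Finset.sum_congr rfl (fun t ht => hterm t (Finset.mem_filter.mp ht).2),
    ← Finset.mul_sum, hsum, hterm y hy]
  have hc : Real.exp (η x) / μ.real {ω | R ω = true ∧ (Z ω, U ω) = x} ≠ 0 := by positivity
  rw [mul_div_mul_left _ _ hc]
  rfl
end

section
/- Representation of the conditional outcome distribution among nonrespondents via the full-data factorization (equation (3.1) of the paper, discrete case): Let (Y, Z, U, R) take values in finite sets with R ∈ {0,1}, write X = (Z,U), π(y,x) = P(R=1 | Y=y, X=x), and suppose the exclusion restriction holds: P(Y=y | Z=z, U=u) = P(Y=y | U=u) whenever P(Z=z, U=u) > 0 and P(U=u) > 0. Then for every x = (z,u) with P(R=0, X=x) > 0 and every y with P(Y=y, X=x) > 0: P(Y=y | R=0, X=x) = (1 − π(y,x)) · P(Y=y | U=u) / Σ_{t, P(Y=t,X=x)>0} (1 − π(t,x)) · P(Y=t | U=u). -/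
open MeasureTheory

open Classical in
/-- **Representation of the conditional outcome distribution among
nonrespondents via the full-data factorization (equation (3.1) of the paper,
discrete case).**
All variables take finitely many values, `X = (Z,U)`,
`π(y,x) = P(R=1 | Y=y, X=x)` is the extended propensity score, and the exclusion
restriction holds: `P(Y=y | Z=z, U=u) = P(Y=y | U=u)` whenever
`P(Z=z, U=u) > 0` and `P(U=u) > 0`.  Then for every `x = (z,u)` with
`P(R=0, X=x) > 0` and every `y` with `P(Y=y, X=x) > 0`:
`P(Y=y | R=0, X=x) = (1 − π(y,x))·P(Y=y | U=u) /
  Σ_{t : P(Y=t,X=x) > 0} (1 − π(t,x))·P(Y=t | U=u)`. -/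
theorem nonrespondent_density_full_data_factorization
    {Ω 𝒴 𝒵 𝒰 : Type*} [MeasurableSpace Ω]
    [Fintype 𝒴] [MeasurableSpace 𝒴] [MeasurableSingletonClass 𝒴]
    [Fintype 𝒵] [MeasurableSpace 𝒵] [MeasurableSingletonClass 𝒵]
    [Fintype 𝒰] [MeasurableSpace 𝒰] [MeasurableSingletonClass 𝒰]
    (μ : Measure Ω) [IsProbabilityMeasure μ]
    (Y : Ω → 𝒴) (hY : Measurable Y)
    (Z : Ω → 𝒵) (hZ : Measurable Z)
    (U : Ω → 𝒰) (hU : Measurable U)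
    (R : Ω → Bool) (hR : Measurable R)
    (hexcl : ∀ (y : 𝒴) (z : 𝒵) (u : 𝒰),
      0 < μ {ω | Z ω = z ∧ U ω = u} → 0 < μ {ω | U ω = u} →
      condP μ {ω | Y ω = y} {ω | Z ω = z ∧ U ω = u}
        = condP μ {ω | Y ω = y} {ω | U ω = u}) :
    ∀ (z : 𝒵) (u : 𝒰),
      0 < μ {ω | R ω = false ∧ (Z ω, U ω) = (z, u)} →
      ∀ y : 𝒴, 0 < μ {ω | Y ω = y ∧ (Z ω, U ω) = (z, u)} →
        condP μ {ω | Y ω = y} {ω | R ω = false ∧ (Z ω, U ω) = (z, u)}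
          = (1 - condP μ {ω | R ω = true} {ω | Y ω = y ∧ (Z ω, U ω) = (z, u)})
              * condP μ {ω | Y ω = y} {ω | U ω = u}
            / ∑ t ∈ Finset.univ.filter
                (fun t : 𝒴 => 0 < μ {ω | Y ω = t ∧ (Z ω, U ω) = (z, u)}),
                (1 - condP μ {ω | R ω = true} {ω | Y ω = t ∧ (Z ω, U ω) = (z, u)})
                  * condP μ {ω | Y ω = t} {ω | U ω = u} := by
  intro z u hRX y hy
  simp only [Prod.mk.injEq] at hRX hy ⊢
  have mB : MeasurableSet {ω | Z ω = z ∧ U ω = u} :=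
    (hZ (measurableSet_singleton z)).inter (hU (measurableSet_singleton u))
  have mY : ∀ t, MeasurableSet {ω | Y ω = t} := fun t => hY (measurableSet_singleton t)
  have mR : ∀ b, MeasurableSet {ω | R ω = b} := fun b => hR (measurableSet_singleton b)
  have hB : 0 < μ {ω | Z ω = z ∧ U ω = u} :=
    hRX.trans_le (measure_mono (fun ω h => h.2))
  have hUu : 0 < μ {ω | U ω = u} := hB.trans_le (measure_mono (fun ω h => h.2))
  have hBr : 0 < (μ {ω | Z ω = z ∧ U ω = u}).toReal :=
    ENNReal.toReal_pos hB.ne' (measure_ne_top _ _)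
  have hRr : 0 < (μ {ω | R ω = false ∧ Z ω = z ∧ U ω = u}).toReal :=
    ENNReal.toReal_pos hRX.ne' (measure_ne_top _ _)
  have key : ∀ t : 𝒴, 0 < μ {ω | Y ω = t ∧ Z ω = z ∧ U ω = u} →
      (1 - condP μ {ω | R ω = true} {ω | Y ω = t ∧ Z ω = z ∧ U ω = u})
        * condP μ {ω | Y ω = t} {ω | U ω = u}
      = (μ ({ω | Y ω = t} ∩ {ω | R ω = false ∧ Z ω = z ∧ U ω = u})).toReal
        / (μ {ω | Z ω = z ∧ U ω = u}).toReal := by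
    intro t ht
    rw [← hexcl t z u hB hUu]
    have htr : 0 < (μ {ω | Y ω = t ∧ Z ω = z ∧ U ω = u}).toReal :=
      ENNReal.toReal_pos ht.ne' (measure_ne_top _ _)
    have e1 : {ω | Y ω = t} ∩ {ω | Z ω = z ∧ U ω = u}
        = {ω | Y ω = t ∧ Z ω = z ∧ U ω = u} := rfl
    have e2 : (μ ({ω | R ω = true} ∩ {ω | Y ω = t ∧ Z ω = z ∧ U ω = u})).toReal
        + (μ ({ω | Y ω = t} ∩ {ω | R ω = false ∧ Z ω = z ∧ U ω = u})).toReal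
        = (μ {ω | Y ω = t ∧ Z ω = z ∧ U ω = u}).toReal := by
      rw [← ENNReal.toReal_add (measure_ne_top _ _) (measure_ne_top _ _),
        ← measure_inter_add_diff {ω | Y ω = t ∧ Z ω = z ∧ U ω = u} (mR true)]
      congr 3
      · rw [Set.inter_comm]
      · ext ω
        simp only [Set.mem_inter_iff, Set.mem_diff, Set.mem_setOf_eq, Bool.not_eq_true]
        tauto
    unfold condP
    rw [e1]
    field_simp
    linarith
  have hsum : ∑ t ∈ Finset.univ.filter
        (fun t : 𝒴 => 0 < μ {ω | Y ω = t ∧ Z ω = z ∧ U ω = u}),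
        (μ ({ω | Y ω = t} ∩ {ω | R ω = false ∧ Z ω = z ∧ U ω = u})).toReal
      = (μ {ω | R ω = false ∧ Z ω = z ∧ U ω = u}).toReal := by
    rw [Finset.sum_filter_of_ne]
    · rw [← ENNReal.toReal_sum (fun _ _ => measure_ne_top _ _),
        ← measure_biUnion_finset]
      · congr 2
        ext ω
        simp
      · intro a _ b _ hab
        refine Set.disjoint_left.2 fun ω h1 h2 => hab ?_
        exact h1.1.symm.trans h2.1
      · intro t _
        exact (mY t).inter ((mR false).inter mB)
    · intro t _ hne
      have h0 : μ ({ω | Y ω = t} ∩ {ω | R ω = false ∧ Z ω = z ∧ U ω = u}) ≠ 0 := by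
        intro h
        simp [h] at hne
      exact (pos_iff_ne_zero.2 h0).trans_le (measure_mono (fun ω h => ⟨h.1, h.2.2⟩))
  rw [Finset.sum_congr rfl (fun t ht => key t (Finset.mem_filter.1 ht).2), key y hy,
    ← Finset.sum_div, hsum]
  unfold condP
  field_simp
end

section
/- Nonidentifiability of the complete-data distribution under exclusion restriction alone (Example 1 of the paper): There exist two probability distributions P and P′ for a triple (Y, Z, R) with values in {0,1}³ such that (i) Y and Z are independent under both P and P′ (exclusion restriction with no covariates); (ii) P(R=1 | Y=y, Z=z) > 0 and P′(R=1 | Y=y, Z=z) > 0 for all y, z ∈ {0,1} (positivity); (iii) the induced observed-data distributions coincide: P(Z=z) = P′(Z=z) and P(Y=y, R=1 | Z=z) = P′(Y=y, R=1 | Z=z) for all y, z ∈ {0,1}; and yet (iv) P(Y=1) ≠ P′(Y=1). -/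
/-- **Nonidentifiability of the complete-data distribution under the exclusion
restriction alone (Example 1 of the paper).**
There exist two probability distributions `p` and `q` for a triple
`(Y, Z, R) ∈ {0,1}³` (encoded as `p y z r` = probability of `Y=y, Z=z, R=r`,
with `true = 1` and `false = 0`) such that
(i) `Y` and `Z` are independent under both;
(ii) `P(R=1 | Y=y, Z=z) > 0` for all `y, z` under both (positivity);
(iii) the induced observed-data distributions coincide:
`P(Z=z)` and `P(Y=y, R=1 | Z=z)` agree for all `y, z`; and yet
(iv) `P(Y=1)` differs between the two. -/
theorem nonidentifiability_exclusion_only :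
    ∃ p q : Bool → Bool → Bool → ℝ,
      -- p and q are probability distributions on {0,1}³
      (∀ y z r, 0 ≤ p y z r) ∧ (∑ y : Bool, ∑ z : Bool, ∑ r : Bool, p y z r) = 1 ∧
      (∀ y z r, 0 ≤ q y z r) ∧ (∑ y : Bool, ∑ z : Bool, ∑ r : Bool, q y z r) = 1 ∧
      -- (i) independence of Y and Z under p and under q (exclusion restriction)
      (∀ y z, (∑ r : Bool, p y z r)
        = (∑ z' : Bool, ∑ r : Bool, p y z' r) * (∑ y' : Bool, ∑ r : Bool, p y' z r)) ∧
      (∀ y z, (∑ r : Bool, q y z r)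
        = (∑ z' : Bool, ∑ r : Bool, q y z' r) * (∑ y' : Bool, ∑ r : Bool, q y' z r)) ∧
      -- (ii) positivity of the propensity score: P(R=1 | Y=y, Z=z) > 0
      (∀ y z, 0 < p y z true / (∑ r : Bool, p y z r)) ∧
      (∀ y z, 0 < q y z true / (∑ r : Bool, q y z r)) ∧
      -- (iii) same observed-data distribution: P(Z=z) and P(Y=y, R=1 | Z=z)
      (∀ z, (∑ y : Bool, ∑ r : Bool, p y z r) = (∑ y : Bool, ∑ r : Bool, q y z r)) ∧
      (∀ y z, p y z true / (∑ y' : Bool, ∑ r : Bool, p y' z r)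
        = q y z true / (∑ y' : Bool, ∑ r : Bool, q y' z r)) ∧
      -- (iv) yet the outcome means differ: P(Y=1) differs
      (∑ z : Bool, ∑ r : Bool, p true z r) ≠ (∑ z : Bool, ∑ r : Bool, q true z r) := by
  refine ⟨fun _ _ _ => 1 / 8,
    fun y _ r => if r then 1 / 8 else if y then 3 / 16 else 1 / 16,
    ?_, ?_, ?_, ?_, ?_, ?_, ?_, ?_, ?_, ?_, ?_⟩
  all_goals
    simp only [Fintype.sum_bool, Bool.forall_bool]
    norm_num
end

section
/- Identification of the binary exponential tilting model with an instrumental variable (binary case of the identification result under Assumptions 1–3): For parameters θ = (p_y, p_z, η₀, η₁, γ) ∈ (0,1) × (0,1) × ℝ³, let P_θ be the law of (Y, Z, R) on {0,1}³ in which Y ~ Bernoulli(p_y) and Z ~ Bernoulli(p_z) are independent, and P_θ(R=1 | Y=y, Z=z) = expit(η_z + γ·y). Let θ and θ′ = (p′_y, p′_z, η′₀, η′₁, γ′) be two parameter vectors such that the induced observed-data distributions coincide: P_θ(Z=z) = P_{θ′}(Z=z) and P_θ(Y=y, R=1 | Z=z) = P_{θ′}(Y=y, R=1 | Z=z) for all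 y, z ∈ {0,1}. Suppose further (Assumption 3) that the ratio r(y,z) = expit(η_z + γ·y)/expit(η′_z + γ′·y) is either constant in (y,z) ∈ {0,1}², or there exist y, z, z′ ∈ {0,1} with r(y,z) ≠ r(y,z′) (i.e., the ratio varies with z). Then θ = θ′. -/
/-- `Bernoulli p` evaluated at a Boolean value: `B p true = p`, `B p false = 1 − p`. -/
def bern (p : ℝ) (y : Bool) : ℝ := if y then p else 1 - p

/-- **Identification of the binary exponential tilting model with an
instrumental variable (binary case of the identification result under
Assumptions 1–3).**
Parameters `θ = (py, pz, η₀, η₁, γ)` with `py, pz ∈ (0,1)` index the law of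
`(Y, Z, R)` on `{0,1}³` in which `Y ∼ Bernoulli(py)` and `Z ∼ Bernoulli(pz)` are
independent and `P(R=1 | Y=y, Z=z) = expit(η_z + γ·y)`.  If two parameter
vectors `θ` and `θ'` induce the same observed-data distribution, i.e.
`P_θ(Z=z) = P_{θ'}(Z=z)` and `P_θ(Y=y, R=1 | Z=z) = P_{θ'}(Y=y, R=1 | Z=z)` for
all `y, z`, and moreover (Assumption 3) the ratio
`r(y,z) = expit(η_z + γ·y)/expit(η'_z + γ'·y)` is either constant in `(y,z)` or
varies with `z`, then `θ = θ'`. -/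
theorem identification_binary_exponential_tilting
    (py pz η₀ η₁ γ py' pz' η₀' η₁' γ' : ℝ)
    (hpy : py ∈ Set.Ioo (0 : ℝ) 1) (hpz : pz ∈ Set.Ioo (0 : ℝ) 1)
    (hpy' : py' ∈ Set.Ioo (0 : ℝ) 1) (hpz' : pz' ∈ Set.Ioo (0 : ℝ) 1)
    (r : Bool → Bool → ℝ)
    (hr : r = fun y z =>
      expit ((if z then η₁ else η₀) + γ * (if y then 1 else 0))
        / expit ((if z then η₁' else η₀') + γ' * (if y then 1 else 0)))
    -- observed-data distributions coincide: marginal law of Z ...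
    (hobsZ : ∀ z : Bool, bern pz z = bern pz' z)
    -- ... and the sub-distributions P(Y = y, R = 1 | Z = z)
    (hobs : ∀ y z : Bool,
      bern py y * expit ((if z then η₁ else η₀) + γ * (if y then 1 else 0))
        = bern py' y * expit ((if z then η₁' else η₀') + γ' * (if y then 1 else 0)))
    -- Assumption 3: the ratio is constant, or it varies with z
    (hA3 : (∀ y z y' z' : Bool, r y z = r y' z')
        ∨ (∃ y z z' : Bool, r y z ≠ r y z')) :
    py = py' ∧ pz = pz' ∧ η₀ = η₀' ∧ η₁ = η₁' ∧ γ = γ' := by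
  have epos : ∀ t, 0 < expit t := fun t => by unfold expit; positivity
  have einj : ∀ s t, expit s = expit t → s = t := by
    intro s t h
    unfold expit at h
    have h1 := inv_injective h
    have h2 : Real.exp (-s) = Real.exp (-t) := by linarith
    have h3 := Real.exp_injective h2
    linarith
  have bpos : ∀ y, 0 < bern py y := by
    intro y
    cases y
    · simpa [bern] using hpy.2
    · simpa [bern] using hpy.1
  have hrv : ∀ y z, r y z = bern py' y / bern py y := by
    intro y z
    rw [hr]
    show expit _ / expit _ = _
    rw [div_eq_div_iff (epos _).ne' (bpos y).ne', mul_comm]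
    exact hobs y z
  have hc : r true true = r false true := by
    rcases hA3 with h | ⟨y, z, z', h⟩
    · exact h _ _ _ _
    · exact absurd ((hrv y z).trans (hrv y z').symm) h
  rw [hrv, hrv, div_eq_div_iff (bpos _).ne' (bpos _).ne'] at hc
  have hp : py = py' := by
    simp only [bern, if_true, Bool.false_eq_true, if_false] at hc
    linarith
  subst hp
  have key := fun y z => einj _ _ (mul_left_cancel₀ (bpos y).ne' (hobs y z))
  have k0 := key false false
  have k1 := key false true
  have k2 := key true true
  have kz := hobsZ true
  simp [bern] at k0 k1 k2 kz
  exact ⟨rfl, kz, k0, k1, by linarith⟩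
end
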